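/- Fix a real number q > 0. Let Σ be a finite type with 8 elements, c : Σ → Σ an involution with no fixed points, and α : Σ → ℂ a function such that α(σ)·conj(α(σ)) = q and α(c(σ)) = conj(α(σ)) for every σ ∈ Σ. If I and J are exotic subsets with |I ∩ J| = 3, then every σ ∈ I \ J satisfies α(σ)² = q; in particular α(σ) is real and equals ±√q. -/

import Mathlib

open Finset

/-- A finset `I` of Frobenius eigenvalue indices is *exotic* if it has four elements,
the product of the corresponding eigenvalues is `q²`, and for every `n ≥ 1` and all
distinct `σ, τ ∈ I` one has `α(σ)ⁿ ≠ conj(α(τ))ⁿ`. -/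
def IsExotic (q : ℝ) {S : Type*} (α : S → ℂ) (I : Finset S) : Prop :=
  I.card = 4 ∧ (∏ σ ∈ I, α σ) = (q : ℂ) ^ 2 ∧
    ∀ n : ℕ, 1 ≤ n → ∀ σ ∈ I, ∀ τ ∈ I, σ ≠ τ →
      α σ ^ n ≠ (starRingEnd ℂ) (α τ) ^ n

/-- An exotic set contains no index together with its conjugate. -/
lemma IsExotic.conj_notMem {q : ℝ} {S : Type*} {α : S → ℂ} {I : Finset S} (hI : IsExotic q α I)
    {c : S → S} (hcfix : ∀ σ, c σ ≠ σ) (hconj : ∀ σ, α (c σ) = (starRingEnd ℂ) (α σ))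
    {σ : S} (hσ : σ ∈ I) : c σ ∉ I := fun h =>
  hI.2.2 1 le_rfl (c σ) h σ hσ (hcfix σ) (by rw [hconj])

/-- An exotic set together with its conjugate exhausts the index type. -/
lemma IsExotic.mem_or_conj_mem {q : ℝ} {S : Type*} [Fintype S] [DecidableEq S]
    (hcard : Fintype.card S = 8) {α : S → ℂ} {I : Finset S} (hI : IsExotic q α I)
    {c : S → S} (hc : Function.Involutive c) (hcfix : ∀ σ, c σ ≠ σ)
    (hconj : ∀ σ, α (c σ) = (starRingEnd ℂ) (α σ)) (τ : S) : τ ∈ I ∨ c τ ∈ I := by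
  have hdisj : Disjoint I (I.image c) := by
    rw [Finset.disjoint_right]
    intro x hx
    obtain ⟨y, hy, rfl⟩ := Finset.mem_image.mp hx
    exact hI.conj_notMem hcfix hconj hy
  have huniv : I ∪ I.image c = Finset.univ := by
    rw [← Finset.card_eq_iff_eq_univ, Finset.card_union_of_disjoint hdisj,
      Finset.card_image_of_injective _ hc.injective, hI.1, hcard]
  have hτ : τ ∈ I ∪ I.image c := huniv ▸ Finset.mem_univ τ
  rcases Finset.mem_union.mp hτ with h | h
  · exact Or.inl h
  · obtain ⟨y, hy, rfl⟩ := Finset.mem_image.mp h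
    exact Or.inr (by rwa [hc y])

/-- **Lemma 5.11 (cf. Lemma 5.12).** If `I, J` are exotic subsets meeting in three
elements, then for every `σ ∈ I \ J` one has `α(σ)² = q`; in particular `α(σ)` is
real and equals `±√q`. -/
theorem stmt_11 (q : ℝ) (hq : 0 < q)
    (S : Type*) [Fintype S] [DecidableEq S] (hcard : Fintype.card S = 8)
    (c : S → S) (hc : Function.Involutive c) (hcfix : ∀ σ, c σ ≠ σ)
    (α : S → ℂ)
    (hweil : ∀ σ, α σ * (starRingEnd ℂ) (α σ) = (q : ℂ))
    (hconj : ∀ σ, α (c σ) = (starRingEnd ℂ) (α σ))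
    (I J : Finset S) (hI : IsExotic q α I) (hJ : IsExotic q α J)
    (hIJ : (I ∩ J).card = 3) :
    ∀ σ ∈ I \ J, α σ ^ 2 = (q : ℂ) ∧
      (α σ = (Real.sqrt q : ℂ) ∨ α σ = -(Real.sqrt q : ℂ)) := by
  have hα : ∀ ρ, α ρ ≠ 0 := by
    intro ρ h
    have := hweil ρ
    rw [h, zero_mul] at this
    exact hq.ne' (by exact_mod_cast this.symm)
  intro σ hσ
  have hIcard : (I \ J).card = 1 := by
    have := Finset.card_sdiff_add_card_inter I J
    have := hI.1
    omega
  have hJcard : (J \ I).card = 1 := by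
    have := Finset.card_sdiff_add_card_inter J I
    rw [Finset.inter_comm] at this
    have := hJ.1
    omega
  obtain ⟨σ', hσ'⟩ := Finset.card_eq_one.mp hIcard
  obtain ⟨τ, hτ⟩ := Finset.card_eq_one.mp hJcard
  obtain rfl : σ = σ' := by simpa [hσ'] using hσ
  have hτJ := Finset.mem_sdiff.mp (hτ ▸ Finset.mem_singleton_self τ)
  have hprod : α σ = α τ := by
    have h1 := Finset.prod_inter_mul_prod_sdiff I J α
    have h2 := Finset.prod_inter_mul_prod_sdiff J I α
    rw [hσ', Finset.prod_singleton, hI.2.1] at h1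
    rw [hτ, Finset.prod_singleton, hJ.2.1, Finset.inter_comm] at h2
    exact mul_left_cancel₀ (Finset.prod_ne_zero_iff.mpr fun ρ _ => hα ρ) (h1.trans h2.symm)
  have hcτ : c τ = σ := by
    have hcI := (hI.mem_or_conj_mem hcard hc hcfix hconj τ).resolve_left hτJ.2
    have hcJ : c τ ∉ J := hJ.conj_notMem hcfix hconj hτJ.1
    simpa [hσ'] using Finset.mem_sdiff.mpr ⟨hcI, hcJ⟩
  have hsq : α σ ^ 2 = (q : ℂ) := by
    have hreal : α σ = (starRingEnd ℂ) (α σ) := by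
      conv_lhs => rw [← hcτ, hconj, ← hprod]
    rw [sq]
    nth_rewrite 2 [hreal]
    exact hweil σ
  refine ⟨hsq, sq_eq_sq_iff_eq_or_eq_neg.mp ?_⟩
  rw [hsq, ← Complex.ofReal_pow, Real.sq_sqrt hq.le]
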